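/- arXiv:2408.06035 — 3 statements merged into one kernel-verified Lean document; each statement's English description precedes it below -/
import Mathlib

section
/- (Symbolic execution soundness.) If (α, β) is a maximal symbolic path of a program P and σ is a store satisfying the path condition α, then the unique maximal execution from ⟨P, σ⟩ is finite (it reaches skip), and obs(P, σ) equals the concrete observation sequence obtained by evaluating β at σ, i.e., it has length |β| and its i-th store maps each variable x to ⟦β(i)(x)⟧σ. -/
namespace HyRep

/-- A (concrete) store maps program variables to integers. -/
abbrev Store (X : Type) := X → ℤ

/-- Programs of the simple while-language (with shallowly embedded integer
and Boolean expressions over the variables `X`). -/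
inductive Prog (X : Type) : Type where
  | skip : Prog X
  | assign (x : X) (e : Store X → ℤ) : Prog X
  | ite (b : Store X → Bool) (p q : Prog X) : Prog X
  | whileLoop (b : Store X → Bool) (p : Prog X) : Prog X
  | seq (p q : Prog X) : Prog X
  | observe : Prog X

/-- A configuration is a program together with a store. -/
abbrev Config (X : Type) := Prog X × Store X

/-- The labelled small-step semantics: the label `none` is the silent label ε,
while `some σ` is the observation of the store `σ` (emitted by `observe`). -/
inductive Step {X : Type} [DecidableEq X] :
    Config X → Option (Store X) → Config X → Prop where
  | assign {x : X} {e : Store X → ℤ} {σ : Store X} :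
      Step (.assign x e, σ) none (.skip, Function.update σ x (e σ))
  | observe {σ : Store X} : Step (.observe, σ) (some σ) (.skip, σ)
  | iteTrue {b : Store X → Bool} {p q : Prog X} {σ : Store X} (h : b σ = true) :
      Step (.ite b p q, σ) none (p, σ)
  | iteFalse {b : Store X → Bool} {p q : Prog X} {σ : Store X} (h : b σ = false) :
      Step (.ite b p q, σ) none (q, σ)
  | whileTrue {b : Store X → Bool} {p : Prog X} {σ : Store X} (h : b σ = true) :
      Step (.whileLoop b p, σ) none (.seq p (.whileLoop b p), σ)
  | whileFalse {b : Store X → Bool} {p : Prog X} {σ : Store X} (h : b σ = false) :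
      Step (.whileLoop b p, σ) none (.skip, σ)
  | seqSkip {p : Prog X} {σ : Store X} : Step (.seq .skip p, σ) none (p, σ)
  | seqStep {p p' q : Prog X} {σ σ' : Store X} {μ : Option (Store X)}
      (h : Step (p, σ) μ (p', σ')) : Step (.seq p q, σ) μ (.seq p' q, σ')

/-- An execution from configuration `C`: a (finite or infinite) sequence of
labelled small steps.  `len : ℕ∞` is the number of steps; `cfg i` is the `i`-th
configuration and `lbl i` the label of the step from `cfg i` to `cfg (i+1)`
(the values of `cfg`/`lbl` beyond `len` are irrelevant). -/
structure Exec {X : Type} [DecidableEq X] (C : Config X) where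
  len : ℕ∞
  cfg : ℕ → Config X
  lbl : ℕ → Option (Store X)
  init : cfg 0 = C
  step : ∀ i : ℕ, (i : ℕ∞) + 1 ≤ len → Step (cfg i) (lbl i) (cfg (i + 1))

/-- An execution is maximal if it is infinite or ends in a configuration whose
program component is `skip`. -/
def Exec.Maximal {X : Type} [DecidableEq X] {C : Config X} (ρ : Exec C) : Prop :=
  ρ.len = ⊤ ∨ ∃ n : ℕ, ρ.len = (n : ℕ∞) ∧ (ρ.cfg n).1 = Prog.skip

/-- The indices (within the length of the execution) at which an observation
(a non-ε label) is emitted. -/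
def Exec.ObsIdx {X : Type} [DecidableEq X] {C : Config X} (ρ : Exec C) : ℕ → Prop :=
  fun i => (i : ℕ∞) + 1 ≤ ρ.len ∧ (ρ.lbl i).isSome

/-- A (finite or infinite) trace: a sequence of stores of length `len`
(values of `get` beyond `len` are irrelevant). -/
structure Trace (X : Type) where
  len : ℕ∞
  get : ℕ → Store X

open Classical in
/-- The observation sequence of an execution: the sequence of observed stores,
obtained by removing all ε labels. -/
noncomputable def Exec.obs {X : Type} [DecidableEq X] {C : Config X}
    (ρ : Exec C) : Trace X where
  len := if h : {i | ρ.ObsIdx i}.Finite then (h.toFinset.card : ℕ∞) else ⊤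
  get := fun k => (ρ.lbl (Nat.nth ρ.ObsIdx k)).getD (fun _ => 0)

open Classical in
/-- The observation sequence `obs(P, σ)` along the (unique) maximal execution
from `⟨P, σ⟩`. -/
noncomputable def obsTrace {X : Type} [DecidableEq X] (P : Prog X) (σ : Store X) :
    Trace X :=
  if h : ∃ ρ : Exec (P, σ), ρ.Maximal then h.choose.obs else ⟨0, fun _ _ => 0⟩

/-- `Traces(P)`: the set of observation sequences of maximal executions of `P`. -/
def Traces {X : Type} [DecidableEq X] (P : Prog X) : Set (Trace X) :=
  { t | ∃ (σ : Store X) (ρ : Exec (P, σ)), ρ.Maximal ∧ t = ρ.obs }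

/-- A program is terminating if all of its (maximal) executions are finite. -/
def Terminating {X : Type} [DecidableEq X] (P : Prog X) : Prop :=
  ∀ (σ : Store X) (ρ : Exec (P, σ)), ρ.Maximal → ∃ n : ℕ, ρ.len = (n : ℕ∞)

/-! ### Symbolic execution -/

/-- A symbolic store maps each variable to an (integer) expression over `X`. -/
abbrev SymStore (X : Type) := X → Store X → ℤ

/-- A path condition: a first-order condition on stores. -/
abbrev PathCond (X : Type) := Store X → Prop

/-- Symbolic configurations `⟨P, ν, α, β⟩`. -/
abbrev SymConfig (X : Type) := Prog X × SymStore X × PathCond X × List (SymStore X)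

/-- Substitute the symbolic store `ν` into the integer expression `e`. -/
def symEvalA {X : Type} (e : Store X → ℤ) (ν : SymStore X) : Store X → ℤ :=
  fun σ => e fun x => ν x σ

/-- Substitute the symbolic store `ν` into the Boolean expression `b`. -/
def symEvalB {X : Type} (b : Store X → Bool) (ν : SymStore X) : Store X → Bool :=
  fun σ => b fun x => ν x σ

/-- Small-step symbolic execution. -/
inductive SymStep {X : Type} [DecidableEq X] : SymConfig X → SymConfig X → Prop where
  | assign {x : X} {e : Store X → ℤ} {ν : SymStore X} {α : PathCond X}
      {β : List (SymStore X)} :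
      SymStep (.assign x e, ν, α, β) (.skip, Function.update ν x (symEvalA e ν), α, β)
  | observe {ν : SymStore X} {α : PathCond X} {β : List (SymStore X)} :
      SymStep (.observe, ν, α, β) (.skip, ν, α, β ++ [ν])
  | iteTrue {b : Store X → Bool} {p q : Prog X} {ν : SymStore X} {α : PathCond X}
      {β : List (SymStore X)} :
      SymStep (.ite b p q, ν, α, β) (p, ν, fun σ => α σ ∧ symEvalB b ν σ = true, β)
  | iteFalse {b : Store X → Bool} {p q : Prog X} {ν : SymStore X} {α : PathCond X}
      {β : List (SymStore X)} :
      SymStep (.ite b p q, ν, α, β) (q, ν, fun σ => α σ ∧ symEvalB b ν σ = false, β)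
  | whileTrue {b : Store X → Bool} {p : Prog X} {ν : SymStore X} {α : PathCond X}
      {β : List (SymStore X)} :
      SymStep (.whileLoop b p, ν, α, β)
        (.seq p (.whileLoop b p), ν, fun σ => α σ ∧ symEvalB b ν σ = true, β)
  | whileFalse {b : Store X → Bool} {p : Prog X} {ν : SymStore X} {α : PathCond X}
      {β : List (SymStore X)} :
      SymStep (.whileLoop b p, ν, α, β) (.skip, ν, fun σ => α σ ∧ symEvalB b ν σ = false, β)
  | seqSkip {p : Prog X} {ν : SymStore X} {α : PathCond X} {β : List (SymStore X)} :
      SymStep (.seq .skip p, ν, α, β) (p, ν, α, β)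
  | seqStep {p p' q : Prog X} {ν ν' : SymStore X} {α α' : PathCond X}
      {β β' : List (SymStore X)} (h : SymStep (p, ν, α, β) (p', ν', α', β')) :
      SymStep (.seq p q, ν, α, β) (.seq p' q, ν', α', β')

/-- The initial symbolic store `ν₀`, mapping each variable to itself. -/
def initSym {X : Type} : SymStore X := fun x σ => σ x

/-- A symbolic path: a path condition together with a symbolic observation sequence. -/
abbrev SymPath (X : Type) := PathCond X × List (SymStore X)

/-- `(α, β)` is a symbolic path of `P`: it is reached by some finite symbolic
execution starting from `⟨P, ν₀, true, ε⟩`. -/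
def IsSymPath {X : Type} [DecidableEq X] (P : Prog X) (p : SymPath X) : Prop :=
  ∃ (P' : Prog X) (ν : SymStore X),
    Relation.ReflTransGen SymStep (P, initSym, fun _ => True, []) (P', ν, p.1, p.2)

/-- `(α, β)` is a maximal symbolic path of `P`: the reached program is `skip`. -/
def IsMaxSymPath {X : Type} [DecidableEq X] (P : Prog X) (p : SymPath X) : Prop :=
  ∃ ν : SymStore X,
    Relation.ReflTransGen SymStep (P, initSym, fun _ => True, []) (.skip, ν, p.1, p.2)

/-- `SymPaths(P)`: all satisfiable symbolic paths of `P`. -/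
def SymPaths {X : Type} [DecidableEq X] (P : Prog X) : Set (SymPath X) :=
  { p | IsSymPath P p ∧ ∃ σ : Store X, p.1 σ }

/-- `SymPaths_max(P)`: all satisfiable maximal symbolic paths of `P`. -/
def SymPathsMax {X : Type} [DecidableEq X] (P : Prog X) : Set (SymPath X) :=
  { p | IsMaxSymPath P p ∧ ∃ σ : Store X, p.1 σ }

/-- Evaluate a symbolic observation sequence at a concrete store,
yielding a concrete observation sequence (a list of stores). -/
def evalObs {X : Type} (β : List (SymStore X)) (σ : Store X) : List (Store X) :=
  β.map fun ν x => ν x σ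

/-- Evaluate a symbolic observation sequence at a concrete store, as a trace. -/
def evalTrace {X : Type} (β : List (SymStore X)) (σ : Store X) : Trace X :=
  ⟨(β.length : ℕ∞), fun i x => (β.getD i initSym) x σ⟩

/-! ### HyperLTL -/

/-- Bodies of HyperLTL formulas over `n` trace variables: atoms are (shallowly
embedded) first-order predicates over the indexed variables `x_{π_j}` (i.e.,
predicates over one store per trace variable); negation occurs only inside
atoms, and the temporal operators are next `X` and weak-until `W`. -/
inductive LTLBody (X : Type) : ℕ → Type 1 where
  | atom {n : ℕ} (θ : (Fin n → Store X) → Prop) : LTLBody X n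
  | and {n : ℕ} (ψ₁ ψ₂ : LTLBody X n) : LTLBody X n
  | or {n : ℕ} (ψ₁ ψ₂ : LTLBody X n) : LTLBody X n
  | next {n : ℕ} (ψ : LTLBody X n) : LTLBody X n
  | wuntil {n : ℕ} (ψ₁ ψ₂ : LTLBody X n) : LTLBody X n

/-- Vacuous satisfaction: some bound trace is shorter than the current position. -/
def vac {X : Type} {n : ℕ} (Tr : Fin n → Trace X) (i : ℕ) : Prop :=
  ∃ j : Fin n, (Tr j).len ≤ (i : ℕ∞)

/-- Satisfaction `Π, i ⊨ ψ` of an LTL body on a trace assignment `Tr`. -/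
def BodySat {X : Type} {n : ℕ} (Tr : Fin n → Trace X) : LTLBody X n → ℕ → Prop
  | .atom θ => fun i => vac Tr i ∨ θ fun j => (Tr j).get i
  | .and ψ₁ ψ₂ => fun i => vac Tr i ∨ (BodySat Tr ψ₁ i ∧ BodySat Tr ψ₂ i)
  | .or ψ₁ ψ₂ => fun i => vac Tr i ∨ (BodySat Tr ψ₁ i ∨ BodySat Tr ψ₂ i)
  | .next ψ => fun i => vac Tr i ∨ BodySat Tr ψ (i + 1)
  | .wuntil ψ₁ ψ₂ => fun i => vac Tr i ∨
      ((∃ j : ℕ, i ≤ j ∧ BodySat Tr ψ₂ j ∧ ∀ k : ℕ, i ≤ k → k < j → BodySat Tr ψ₁ k) ∨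
        ∀ j : ℕ, i ≤ j → BodySat Tr ψ₁ j)

/-- HyperLTL formulas: a quantifier prefix over trace variables followed by an
LTL body; `HyperLTL X n` has `n` already-bound (outer) trace variables. -/
inductive HyperLTL (X : Type) : ℕ → Type 1 where
  | body {n : ℕ} (ψ : LTLBody X n) : HyperLTL X n
  | uall {n : ℕ} (φ : HyperLTL X (n + 1)) : HyperLTL X n
  | uex {n : ℕ} (φ : HyperLTL X (n + 1)) : HyperLTL X n

/-- HyperLTL satisfaction `Π, 0 ⊨_T φ`, with quantifiers ranging over `T`. -/
def HSat {X : Type} (T : Set (Trace X)) :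
    {n : ℕ} → HyperLTL X n → (Fin n → Trace X) → Prop
  | _, .body ψ, Tr => BodySat Tr ψ 0
  | _, .uall φ, Tr => ∀ t ∈ T, HSat T φ (Fin.snoc Tr t)
  | _, .uex φ, Tr => ∃ t ∈ T, HSat T φ (Fin.snoc Tr t)

/-- `P ⊨ φ`, i.e., `∅, 0 ⊨_{Traces(P)} φ`. -/
def Sat {X : Type} [DecidableEq X] (P : Prog X) (φ : HyperLTL X 0) : Prop :=
  HSat (Traces P) φ Fin.elim0

/-- The formula is a `∀*` formula (all quantifiers universal). -/
def IsUniv {X : Type} : {n : ℕ} → HyperLTL X n → Prop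
  | _, .body _ => True
  | _, .uall φ => IsUniv φ
  | _, .uex _ => False

/-- The formula is an `∃*` formula (all quantifiers existential). -/
def IsExist {X : Type} : {n : ℕ} → HyperLTL X n → Prop
  | _, .body _ => True
  | _, .uall _ => False
  | _, .uex φ => IsExist φ

/-- Satisfaction of the `∀ⁿ` HyperLTL formula `∀π₁…∀πₙ. ψ` by program `P`. -/
def SatAll {X : Type} [DecidableEq X] (P : Prog X) {n : ℕ} (ψ : LTLBody X n) : Prop :=
  ∀ Tr : Fin n → Trace X, (∀ j, Tr j ∈ Traces P) → BodySat Tr ψ 0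

/-! ### The encodings -/

/-- The encoding `enc^φ_Ps`: each trace quantifier is resolved on the symbolic
paths in `Ps` (introducing a fresh copy of the program variables, i.e., a store,
and asserting the path condition on it); the body case asserts `acc^ψ_Δ`,
i.e., that the instantiated symbolic observation sequences satisfy `ψ`. -/
def enc {X : Type} (Ps : Set (SymPath X)) :
    {n : ℕ} → HyperLTL X n → (Fin n → Store X) → (Fin n → List (SymStore X)) → Prop
  | _, .body ψ, v, Δ => BodySat (fun j => evalTrace (Δ j) (v j)) ψ 0
  | _, .uall φ, v, Δ => ∀ σ : Store X, ∀ p ∈ Ps, p.1 σ →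
      enc Ps φ (Fin.snoc v σ) (Fin.snoc Δ p.2)
  | _, .uex φ, v, Δ => ∃ σ : Store X, ∃ p ∈ Ps, p.1 σ ∧
      enc Ps φ (Fin.snoc v σ) (Fin.snoc Δ p.2)

/-- The encoding `enc^φ_Ps` for the `∀ⁿ` formula `∀π₁…∀πₙ. ψ`. -/
def encAll {X : Type} {n : ℕ} (ψ : LTLBody X n) (Ps : Set (SymPath X)) : Prop :=
  ∀ (σs : Fin n → Store X) (ps : Fin n → SymPath X),
    (∀ j, ps j ∈ Ps) → (∀ j, (ps j).1 (σs j)) →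
    BodySat (fun j => evalTrace (ps j).2 (σs j)) ψ 0

/-- `t ≠_{X_out} t'`: at some position within both sequences the stores
differ on some output variable. -/
def OutDiff {X : Type} (Xout : Set X) (t t' : Trace X) : Prop :=
  ∃ i : ℕ, (i : ℕ∞) < t.len ∧ (i : ℕ∞) < t'.len ∧ ∃ x ∈ Xout, t.get i x ≠ t'.get i x

/-- `Q` is a fully transparent repair of `(P, ∀π₁…∀πₙ. ψ)`. -/
def FullyTransparent {X : Type} [DecidableEq X] (Xout : Set X) {n : ℕ}
    (ψ : LTLBody X n) (P Q : Prog X) : Prop :=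
  SatAll Q ψ ∧
  ∀ σ : Store X, OutDiff Xout (obsTrace P σ) (obsTrace Q σ) →
    ∃ σs : Fin n → Store X, (∃ j, σ = σs j) ∧
      ¬ BodySat (fun j => obsTrace P (σs j)) ψ 0

/-- `Q` is a better repair than `S` w.r.t. `(P, φ)`. -/
def BetterRepair {X : Type} [DecidableEq X] (Xout : Set X) (φ : HyperLTL X 0)
    (P Q S : Prog X) : Prop :=
  Sat Q φ ∧
  (∀ σ : Store X, OutDiff Xout (obsTrace P σ) (obsTrace Q σ) →
      OutDiff Xout (obsTrace P σ) (obsTrace S σ)) ∧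
  (∃ σ : Store X, OutDiff Xout (obsTrace P σ) (obsTrace S σ) ∧
      ¬ OutDiff Xout (obsTrace P σ) (obsTrace Q σ))

/-- The encoding `trans^φ_{Ps_P, Ps_Q}` for fully transparent repair
(for `φ = ∀π₁…∀πₙ. ψ`). -/
def transEnc {X : Type} (Xout : Set X) {n : ℕ} (ψ : LTLBody X n)
    (PP PQ : Set (SymPath X)) : Prop :=
  ∀ σ : Store X,
    (∃ pP ∈ PP, ∃ pQ ∈ PQ, pP.1 σ ∧ pQ.1 σ ∧
      ∃ i < min pP.2.length pQ.2.length, ∃ x ∈ Xout,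
        (pP.2.getD i initSym) x σ ≠ (pQ.2.getD i initSym) x σ) →
    ∃ (σs : Fin n → Store X) (ps : Fin n → SymPath X),
      (∀ j, ps j ∈ PP) ∧ (∀ j, (ps j).1 (σs j)) ∧ (∃ j, σ = σs j) ∧
      ¬ BodySat (fun j => evalTrace (ps j).2 (σs j)) ψ 0

/-- The encoding `iter_{Ps_P, Ps_S, Ps_Q}` for iterative repair. -/
def iterEnc {X : Type} (Xout : Set X) (PP PS PQ : Set (SymPath X)) : Prop :=
  (∀ σ : Store X, ∀ pP ∈ PP, ∀ pS ∈ PS, ∀ pQ ∈ PQ,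
    pP.1 σ → pS.1 σ → pQ.1 σ →
    (∃ i < min pP.2.length pQ.2.length, ∃ x ∈ Xout,
        (pP.2.getD i initSym) x σ ≠ (pQ.2.getD i initSym) x σ) →
    (∃ i < min pP.2.length pS.2.length, ∃ x ∈ Xout,
        (pP.2.getD i initSym) x σ ≠ (pS.2.getD i initSym) x σ)) ∧
  (∃ σ : Store X, ∃ pP ∈ PP, ∃ pS ∈ PS, ∃ pQ ∈ PQ,
    pP.1 σ ∧ pS.1 σ ∧ pQ.1 σ ∧
    (∃ i < min pP.2.length pS.2.length, ∃ x ∈ Xout,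
        (pP.2.getD i initSym) x σ ≠ (pS.2.getD i initSym) x σ) ∧
    (∀ i < min pP.2.length pQ.2.length, ∀ x ∈ Xout,
        (pP.2.getD i initSym) x σ = (pQ.2.getD i initSym) x σ))

/-- A program is loop-free if it contains no `while` statement. -/
def LoopFree {X : Type} : Prog X → Prop
  | .skip => True
  | .assign _ _ => True
  | .observe => True
  | .ite _ p q => LoopFree p ∧ LoopFree q
  | .whileLoop _ _ => False
  | .seq p q => LoopFree p ∧ LoopFree q

/-- The concrete store obtained by evaluating the symbolic store `ν` at `σ`. -/
def evalStore {X : Type} (ν : SymStore X) (σ : Store X) : Store X := fun x => ν x σ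

lemma evalStore_update {X : Type} [DecidableEq X] (ν : SymStore X) (x : X)
    (e : Store X → ℤ) (σ : Store X) :
    evalStore (Function.update ν x (symEvalA e ν)) σ =
      Function.update (evalStore ν σ) x (e (evalStore ν σ)) := by
  funext y
  by_cases h : y = x
  · subst h
    simp only [evalStore, symEvalA, Function.update_self]
    rfl
  · simp [evalStore, h]

lemma not_step_skip {X : Type} [DecidableEq X] {σ : Store X} {μ : Option (Store X)}
    {C : Config X} : ¬ Step (.skip, σ) μ C := by
  intro h
  cases h

/-- The small-step semantics is deterministic. -/
lemma Step.deterministic {X : Type} [DecidableEq X] {C C₁ C₂ : Config X}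
    {μ₁ μ₂ : Option (Store X)} (h₁ : Step C μ₁ C₁) (h₂ : Step C μ₂ C₂) :
    μ₁ = μ₂ ∧ C₁ = C₂ := by
  induction h₁ generalizing μ₂ C₂ with
  | assign => cases h₂; exact ⟨rfl, rfl⟩
  | observe => cases h₂; exact ⟨rfl, rfl⟩
  | iteTrue h => cases h₂ <;> simp_all
  | iteFalse h => cases h₂ <;> simp_all
  | whileTrue h => cases h₂ <;> simp_all
  | whileFalse h => cases h₂ <;> simp_all
  | seqSkip =>
    cases h₂ with
    | seqSkip => exact ⟨rfl, rfl⟩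
    | seqStep h => exact absurd h not_step_skip
  | seqStep h ih =>
    cases h₂ with
    | seqSkip => exact absurd h not_step_skip
    | seqStep h' =>
      obtain ⟨rfl, hC⟩ := ih h'
      cases hC
      exact ⟨rfl, rfl⟩

/-- Every symbolic step whose resulting path condition holds at `σ` is mirrored by a
concrete step emitting the same observation. -/
lemma SymStep.simulation {X : Type} [DecidableEq X] {c c' : SymConfig X}
    (h : SymStep c c') (σ : Store X) (hα : c'.2.2.1 σ) :
    c.2.2.1 σ ∧ ∃ μ : Option (Store X),
      Step (c.1, evalStore c.2.1 σ) μ (c'.1, evalStore c'.2.1 σ) ∧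
        evalObs c'.2.2.2 σ = evalObs c.2.2.2 σ ++ μ.toList := by
  induction h with
  | assign =>
    refine ⟨hα, none, ?_, by simp⟩
    simp only [evalStore_update]
    exact .assign
  | observe => exact ⟨hα, _, .observe, by simp [evalObs]; rfl⟩
  | iteTrue => exact ⟨hα.1, none, .iteTrue hα.2, by simp⟩
  | iteFalse => exact ⟨hα.1, none, .iteFalse hα.2, by simp⟩
  | whileTrue => exact ⟨hα.1, none, .whileTrue hα.2, by simp⟩
  | whileFalse => exact ⟨hα.1, none, .whileFalse hα.2, by simp⟩
  | seqSkip => exact ⟨hα, none, .seqSkip, by simp⟩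
  | seqStep _ ih =>
    obtain ⟨h₁, μ, h₂, h₃⟩ := ih hα
    exact ⟨h₁, μ, .seqStep h₂, h₃⟩

/-- A configuration reached by a maximal execution that admits a step is not the last one. -/
lemma Exec.Maximal.add_one_le_len {X : Type} [DecidableEq X] {C C' : Config X} {ρ : Exec C}
    (hρ : ρ.Maximal) {n : ℕ} (hn : (n : ℕ∞) ≤ ρ.len) {μ : Option (Store X)}
    (h : Step (ρ.cfg n) μ C') : (n : ℕ∞) + 1 ≤ ρ.len := by
  rcases hρ with hlen | ⟨m, hm, hskip⟩
  · simp [hlen]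
  · rw [hm] at hn ⊢
    norm_cast at hn ⊢
    refine Nat.lt_of_le_of_ne hn ?_
    rintro rfl
    rw [← Prod.mk.eta (p := ρ.cfg n), hskip] at h
    exact not_step_skip h

/-- A maximal execution from `⟨P, σ⟩` follows every symbolic execution of `P` whose path
condition holds at `σ`. -/
lemma Exec.Maximal.follows_symbolic {X : Type} [DecidableEq X] {P : Prog X} {σ : Store X}
    {ρ : Exec (P, σ)} (hρ : ρ.Maximal) {c : SymConfig X}
    (h : Relation.ReflTransGen SymStep (P, initSym, fun _ => True, []) c)
    (hα : c.2.2.1 σ) :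
    ∃ n : ℕ, (n : ℕ∞) ≤ ρ.len ∧ ρ.cfg n = (c.1, evalStore c.2.1 σ) ∧
      (List.range n).filterMap ρ.lbl = evalObs c.2.2.2 σ := by
  induction h with
  | refl => exact ⟨0, by simp, ρ.init, rfl⟩
  | tail _ hstep ih =>
    obtain ⟨hα', μ, hμ, hobs⟩ := hstep.simulation σ hα
    obtain ⟨n, hn, hcfg, hlbl⟩ := ih hα'
    rw [← hcfg] at hμ
    have hlt := hρ.add_one_le_len hn hμ
    obtain ⟨hl, hc⟩ := (ρ.step n hlt).deterministic hμ
    refine ⟨n + 1, by exact_mod_cast hlt, hc, ?_⟩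
    rw [List.range_succ, List.filterMap_append, hlbl, hobs, ← hl]
    cases hv : ρ.lbl n <;> simp [hv]

/-- Symbolic execution soundness. If `(α, β)` is a maximal
symbolic path of `P` and `σ` satisfies the path condition `α`, then the unique
maximal execution from `⟨P, σ⟩` is finite (it reaches `skip`), and `obs(P, σ)`
equals the concrete observation sequence obtained by evaluating `β` at `σ`. -/
theorem symbolic_execution_sound {X : Type} [DecidableEq X]
    (P : Prog X) (α : PathCond X) (β : List (SymStore X))
    (hpath : IsMaxSymPath P (α, β)) (σ : Store X) (hα : α σ) :
    ∀ ρ : Exec (P, σ), ρ.Maximal →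
      ∃ n : ℕ, ρ.len = (n : ℕ∞) ∧ (ρ.cfg n).1 = Prog.skip ∧
        (List.range n).filterMap ρ.lbl = evalObs β σ := by
  intro ρ hρ
  obtain ⟨ν, hν⟩ := hpath
  obtain ⟨n, hn, hcfg, hlbl⟩ := hρ.follows_symbolic hν hα
  refine ⟨n, ?_, by rw [hcfg], hlbl⟩
  refine le_antisymm (not_lt.mp fun hlt => ?_) hn
  have hstep := ρ.step n (Order.add_one_le_of_lt hlt)
  rw [hcfg] at hstep
  exact not_step_skip hstep

end HyRep
end

section
/- (Symbolic execution completeness.) If the unique maximal execution from ⟨P, σ⟩ is finite, then there exists a maximal symbolic path (α, β) of P such that σ satisfies α (so (α, β) is satisfiable, i.e., (α, β) ∈ SymPaths_max(P)) and obs(P, σ) is exactly the sequence obtained by evaluating each symbolic store β(i) at σ. -/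
namespace HyRep

/-- A concrete step from the evaluation at `σ` of a symbolic configuration whose path condition
holds at `σ` is matched by a symbolic step. -/
theorem Step.exists_symStep {X : Type} [DecidableEq X] {C C' : Config X} {μ : Option (Store X)}
    (h : Step C μ C') {σ : Store X} {ν : SymStore X} {α : PathCond X} (β : List (SymStore X))
    (hν : (fun x => ν x σ) = C.2) (hα : α σ) :
    ∃ (ν' : SymStore X) (α' : PathCond X) (β' : List (SymStore X)),
      SymStep (C.1, ν, α, β) (C'.1, ν', α', β') ∧ (fun x => ν' x σ) = C'.2 ∧ α' σ ∧
      evalObs β' σ = evalObs β σ ++ μ.toList := by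
  induction h with
  | @assign x e τ =>
    refine ⟨_, _, _, .assign, ?_, hα, by simp⟩
    subst hν
    ext y
    rcases eq_or_ne y x with rfl | hy
    · simp [symEvalA]
    · simp [hy]
  | observe => exact ⟨_, _, _, .observe, hν, hα, by simp [evalObs, hν]⟩
  | iteTrue h => exact ⟨_, _, _, .iteTrue, hν, ⟨hα, by simpa [symEvalB, hν] using h⟩, by simp⟩
  | iteFalse h => exact ⟨_, _, _, .iteFalse, hν, ⟨hα, by simpa [symEvalB, hν] using h⟩, by simp⟩
  | whileTrue h => exact ⟨_, _, _, .whileTrue, hν, ⟨hα, by simpa [symEvalB, hν] using h⟩, by simp⟩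
  | whileFalse h =>
    exact ⟨_, _, _, .whileFalse, hν, ⟨hα, by simpa [symEvalB, hν] using h⟩, by simp⟩
  | seqSkip => exact ⟨_, _, _, .seqSkip, hν, hα, by simp⟩
  | seqStep _ ih =>
    obtain ⟨ν', α', β', hs, h⟩ := ih hν
    exact ⟨ν', α', β', .seqStep hs, h⟩

/-- Every finite prefix of an execution from `(P, σ)` is matched by a symbolic execution of `P`
whose path condition holds at `σ`. -/
theorem Exec.exists_symExec {X : Type} [DecidableEq X] {P : Prog X} {σ : Store X}
    (ρ : Exec (P, σ)) (n : ℕ) (hn : (n : ℕ∞) ≤ ρ.len) :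
    ∃ (ν : SymStore X) (α : PathCond X) (β : List (SymStore X)),
      Relation.ReflTransGen SymStep (P, initSym, fun _ => True, []) ((ρ.cfg n).1, ν, α, β) ∧
      (fun x => ν x σ) = (ρ.cfg n).2 ∧ α σ ∧
      (List.range n).filterMap ρ.lbl = evalObs β σ := by
  induction n with
  | zero =>
    refine ⟨initSym, fun _ => True, [], ?_, ?_, trivial, rfl⟩
    · rw [ρ.init]
    · rw [ρ.init]
      rfl
  | succ k ih =>
    rw [Nat.cast_succ] at hn
    obtain ⟨ν, α, β, hr, hν, hα, hβ⟩ := ih (le_self_add.trans hn)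
    obtain ⟨ν', α', β', hs, hν', hα', hβ'⟩ := (ρ.step k hn).exists_symStep β hν hα
    refine ⟨ν', α', β', hr.tail hs, hν', hα', ?_⟩
    rw [hβ', List.range_succ, List.filterMap_append, hβ]
    cases h : ρ.lbl k <;> simp [h]

/-- Symbolic execution completeness. If the unique maximal
execution from `⟨P, σ⟩` is finite, then there is a maximal symbolic path
`(α, β)` of `P` such that `σ` satisfies `α` (hence `(α, β) ∈ SymPaths_max(P)`)
and `obs(P, σ)` is exactly the evaluation of `β` at `σ`. -/
theorem symbolic_execution_complete {X : Type} [DecidableEq X]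
    (P : Prog X) (σ : Store X) (ρ : Exec (P, σ)) (hmax : ρ.Maximal)
    (n : ℕ) (hlen : ρ.len = (n : ℕ∞)) :
    ∃ (α : PathCond X) (β : List (SymStore X)),
      IsMaxSymPath P (α, β) ∧ α σ ∧ (α, β) ∈ SymPathsMax P ∧
      (List.range n).filterMap ρ.lbl = evalObs β σ := by
  obtain ⟨ν, α, β, hr, -, hα, hβ⟩ := ρ.exists_symExec n hlen.ge
  have hskip : (ρ.cfg n).1 = Prog.skip := by
    rcases hmax with h | ⟨m, hm, h⟩
    · simp [h] at hlen
    · obtain rfl : m = n := by simpa [hm] using hlen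
      exact h
  have hpath : IsMaxSymPath P (α, β) := ⟨ν, hskip ▸ hr⟩
  exact ⟨α, β, hpath, hα, ⟨hpath, σ, hα⟩, hβ⟩

end HyRep
end

section
/- (Proposition 1.) Let φ be a HyperLTL formula and Q a terminating program of the simple while-language such that SymPaths_max(Q) is finite. Then Q ⊨ φ if and only if the first-order formula enc^φ_{SymPaths_max(Q)} is valid. -/
namespace HyRep

/-- Two traces agree if they have the same length and the same stores below it. -/
def Trace.Agree {X : Type} (t t' : Trace X) : Prop :=
  t.len = t'.len ∧ ∀ k : ℕ, (k : ℕ∞) < t.len → t.get k = t'.get k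

/-- Apply a symbolic store to a concrete one. -/
def SymStore.eval {X : Type} (ν : SymStore X) (σ : Store X) : Store X := fun x => ν x σ

theorem SymStore.eval_update {X : Type} [DecidableEq X] (ν : SymStore X) (x : X)
    (e : Store X → ℤ) (σ : Store X) :
    SymStore.eval (Function.update ν x (symEvalA e ν)) σ =
      Function.update (SymStore.eval ν σ) x (e (SymStore.eval ν σ)) := by
  funext y
  by_cases h : y = x
  · subst h; simp only [SymStore.eval, symEvalA, Function.update_self]; rfl
  · simp [SymStore.eval, h]

theorem vac_congr {X : Type} {n : ℕ} {Tr Tr' : Fin n → Trace X}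
    (h : ∀ j, (Tr j).Agree (Tr' j)) (i : ℕ) : vac Tr i ↔ vac Tr' i := by
  simp only [vac, (h _).1]

theorem bodySat_congr {X : Type} {n : ℕ} {Tr Tr' : Fin n → Trace X}
    (h : ∀ j, (Tr j).Agree (Tr' j)) (ψ : LTLBody X n) (i : ℕ) :
    BodySat Tr ψ i ↔ BodySat Tr' ψ i := by
  induction ψ generalizing i with
  | atom θ =>
    simp only [BodySat, ← vac_congr h]
    by_cases hv : vac Tr i
    · simp [hv]
    · have hget : (fun j => (Tr j).get i) = fun j => (Tr' j).get i :=
        funext fun j => (h j).2 i (not_le.1 fun hle => hv ⟨j, hle⟩)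
      rw [hget]
  | and ψ₁ ψ₂ ih₁ ih₂ => simp only [BodySat, vac_congr h, ih₁, ih₂]
  | or ψ₁ ψ₂ ih₁ ih₂ => simp only [BodySat, vac_congr h, ih₁, ih₂]
  | next ψ ih => simp only [BodySat, vac_congr h, ih]
  | wuntil ψ₁ ψ₂ ih₁ ih₂ => simp only [BodySat, vac_congr h, ih₁, ih₂]

theorem length_filterMap_range {γ : Type*} (f : ℕ → Option γ) (p : ℕ → Prop)
    [DecidablePred p] {m : ℕ} (hp : ∀ i < m, p i ↔ (f i).isSome) :
    ((List.range m).filterMap f).length = Nat.count p m := by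
  induction m with
  | zero => simp
  | succ m ih =>
    have hm := hp m (Nat.lt_succ_self m)
    rw [List.range_succ, List.filterMap_append, List.length_append,
      ih fun i hi => hp i (hi.trans (Nat.lt_succ_self m)), Nat.count_succ]
    cases hf : f m <;> simp [hf, hm]

theorem getElem?_filterMap_range {γ : Type*} (f : ℕ → Option γ) (p : ℕ → Prop)
    [DecidablePred p] {m : ℕ} (hp : ∀ i < m, p i ↔ (f i).isSome) {i : ℕ} (hi : i < m)
    (hpi : p i) : ((List.range m).filterMap f)[Nat.count p i]? = f i := by
  induction m with
  | zero => omega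
  | succ m ih =>
    have hp' : ∀ i < m, p i ↔ (f i).isSome := fun i hi => hp i (by omega)
    have hlen := length_filterMap_range f p hp'
    rw [List.range_succ, List.filterMap_append]
    rcases Nat.lt_succ_iff_lt_or_eq.1 hi with hlt | rfl
    · rw [List.getElem?_append_left, ih hp' hlt]
      rw [hlen]
      exact Nat.count_strict_mono hpi hlt
    · rw [List.getElem?_append_right hlen.le, hlen]
      obtain ⟨s, hs⟩ := Option.isSome_iff_exists.1 ((hp i hi).1 hpi)
      simp [hs]

/-- The observations of a finite execution are the labels of its observing steps. -/
theorem Exec.obs_agree {X : Type} [DecidableEq X] {C : Config X} (ρ : Exec C) {n : ℕ}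
    (hn : ρ.len = n) {β : List (SymStore X)} {σ : Store X}
    (hβ : evalObs β σ = (List.range n).filterMap ρ.lbl) :
    ρ.obs.Agree (evalTrace β σ) := by
  classical
  have hidx : ∀ i, ρ.ObsIdx i ↔ i < n ∧ (ρ.lbl i).isSome := by
    intro i
    rw [Exec.ObsIdx, hn]
    exact and_congr_left' (by norm_cast)
  have hp : ∀ i < n, ρ.ObsIdx i ↔ (ρ.lbl i).isSome := fun i hi => by simp [hidx, hi]
  have hfin : {i | ρ.ObsIdx i}.Finite :=
    (Set.finite_Iio n).subset fun i hi => ((hidx i).1 hi).1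
  have hcount : β.length = Nat.count ρ.ObsIdx n := by
    rw [← length_filterMap_range ρ.lbl ρ.ObsIdx hp, ← hβ, evalObs, List.length_map]
  have hcard : hfin.toFinset.card = β.length := by
    rw [hcount, Nat.count_eq_card_filter_range]
    congr 1
    ext i
    simp only [Set.Finite.mem_toFinset, Set.mem_ofPred_eq, Finset.mem_filter, Finset.mem_range]
    exact ⟨fun h => ⟨((hidx i).1 h).1, h⟩, fun h => h.2⟩
  have hlen : ρ.obs.len = β.length := by
    simp only [Exec.obs]
    rw [dif_pos hfin, hcard]
  refine ⟨hlen, fun k hk => ?_⟩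
  rw [hlen, Nat.cast_lt] at hk
  have hk' : ∀ hf : {i | ρ.ObsIdx i}.Finite, k < hf.toFinset.card := fun _ => hcard ▸ hk
  have hmem := Nat.nth_mem k hk'
  have hget := getElem?_filterMap_range ρ.lbl ρ.ObsIdx hp ((hidx _).1 hmem).1 hmem
  rw [Nat.count_nth hk', ← hβ, evalObs, List.getElem?_map, List.getElem?_eq_getElem hk] at hget
  simp only [Exec.obs, evalTrace, ← hget, List.getD_eq_getElem _ _ hk]
  rfl

/-- Symbolic steps are simulated by concrete ones. -/
theorem SymStep.sound {X : Type} [DecidableEq X] {c c' : SymConfig X} (h : SymStep c c')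
    {σ : Store X} (hσ : c'.2.2.1 σ) :
    c.2.2.1 σ ∧ ∃ μ : Option (Store X),
      Step (c.1, SymStore.eval c.2.1 σ) μ (c'.1, SymStore.eval c'.2.1 σ) ∧
        evalObs c'.2.2.2 σ = evalObs c.2.2.2 σ ++ μ.toList := by
  induction h with
  | assign =>
    refine ⟨hσ, none, ?_, by simp⟩
    simp only [SymStore.eval_update]
    exact .assign
  | observe => exact ⟨hσ, _, .observe, by simp [evalObs]; rfl⟩
  | iteTrue => exact ⟨hσ.1, none, .iteTrue hσ.2, by simp⟩
  | iteFalse => exact ⟨hσ.1, none, .iteFalse hσ.2, by simp⟩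
  | whileTrue => exact ⟨hσ.1, none, .whileTrue hσ.2, by simp⟩
  | whileFalse => exact ⟨hσ.1, none, .whileFalse hσ.2, by simp⟩
  | seqSkip => exact ⟨hσ, none, .seqSkip, by simp⟩
  | seqStep _ ih =>
    obtain ⟨hα, μ, hstep, hobs⟩ := ih hσ
    exact ⟨hα, μ, .seqStep hstep, hobs⟩

/-- Concrete steps are simulated by symbolic ones. -/
theorem Step.complete {X : Type} [DecidableEq X] {C C' : Config X} {μ : Option (Store X)}
    (h : Step C μ C') {σ : Store X} {ν : SymStore X} {α : PathCond X}
    {β : List (SymStore X)} (hν : SymStore.eval ν σ = C.2) (hσ : α σ) :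
    ∃ (ν' : SymStore X) (α' : PathCond X) (β' : List (SymStore X)),
      SymStep (C.1, ν, α, β) (C'.1, ν', α', β') ∧ SymStore.eval ν' σ = C'.2 ∧ α' σ ∧
        evalObs β' σ = evalObs β σ ++ μ.toList := by
  induction h with
  | assign =>
    subst hν
    exact ⟨_, _, _, .assign, SymStore.eval_update .., hσ, by simp⟩
  | observe =>
    subst hν
    exact ⟨_, _, _, .observe, rfl, hσ, by simp [evalObs]; rfl⟩
  | iteTrue h => subst hν; exact ⟨_, _, _, .iteTrue, rfl, ⟨hσ, h⟩, by simp⟩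
  | iteFalse h => subst hν; exact ⟨_, _, _, .iteFalse, rfl, ⟨hσ, h⟩, by simp⟩
  | whileTrue h => subst hν; exact ⟨_, _, _, .whileTrue, rfl, ⟨hσ, h⟩, by simp⟩
  | whileFalse h => subst hν; exact ⟨_, _, _, .whileFalse, rfl, ⟨hσ, h⟩, by simp⟩
  | seqSkip => exact ⟨_, _, _, .seqSkip, hν, hσ, by simp⟩
  | seqStep _ ih =>
    obtain ⟨ν', α', β', hstep, hrest⟩ := ih hν
    exact ⟨ν', α', β', .seqStep hstep, hrest⟩

theorem filterMap_range_succ {γ : Type*} (f : ℕ → Option γ) (m : ℕ) :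
    (List.range (m + 1)).filterMap f = (List.range m).filterMap f ++ (f m).toList := by
  rw [List.range_succ, List.filterMap_append]
  cases hf : f m <;> simp [hf]

/-- Every finite prefix of an execution is covered by a symbolic execution. -/
theorem Exec.exists_symbolic {X : Type} [DecidableEq X] {P : Prog X} {σ : Store X}
    (ρ : Exec (P, σ)) (i : ℕ) (hi : (i : ℕ∞) ≤ ρ.len) :
    ∃ (ν : SymStore X) (α : PathCond X) (β : List (SymStore X)),
      Relation.ReflTransGen SymStep (P, initSym, fun _ => True, []) ((ρ.cfg i).1, ν, α, β) ∧
        SymStore.eval ν σ = (ρ.cfg i).2 ∧ α σ ∧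
        evalObs β σ = (List.range i).filterMap ρ.lbl := by
  induction i with
  | zero =>
    rw [ρ.init]
    exact ⟨_, _, _, .refl, rfl, trivial, rfl⟩
  | succ i ih =>
    rw [Nat.cast_succ] at hi
    obtain ⟨ν, α, β, hrun, hν, hα, hβ⟩ := ih (le_self_add.trans hi)
    obtain ⟨ν', α', β', hstep, hν', hα', hβ'⟩ := (ρ.step i hi).complete (β := β) hν hα
    exact ⟨ν', α', β', hrun.tail hstep, hν', hα', by rw [hβ', hβ, filterMap_range_succ]⟩

/-- Every symbolic execution is realised at each store satisfying its path condition. -/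
theorem exists_steps_of_symbolic {X : Type} [DecidableEq X] {P : Prog X} {c : SymConfig X}
    (h : Relation.ReflTransGen SymStep (P, initSym, fun _ => True, []) c)
    {σ : Store X} (hσ : c.2.2.1 σ) :
    ∃ (n : ℕ) (cfg : ℕ → Config X) (lbl : ℕ → Option (Store X)),
      cfg 0 = (P, σ) ∧ (∀ i < n, Step (cfg i) (lbl i) (cfg (i + 1))) ∧
        cfg n = (c.1, SymStore.eval c.2.1 σ) ∧
        evalObs c.2.2.2 σ = (List.range n).filterMap lbl := by
  induction h with
  | refl => exact ⟨0, fun _ => (P, σ), fun _ => none, rfl, by simp, rfl, rfl⟩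
  | @tail c c' _ hstep ih =>
    obtain ⟨hα, μ, hμ, hobs⟩ := hstep.sound hσ
    obtain ⟨n, cfg, lbl, h0, hs, hn, hβ⟩ := ih hα
    refine ⟨n + 1, Function.update cfg (n + 1) (c'.1, SymStore.eval c'.2.1 σ),
      Function.update lbl n μ, ?_, fun i hi => ?_, by simp, ?_⟩
    · rwa [Function.update_of_ne (by omega)]
    · rw [Function.update_of_ne (by omega : i ≠ n + 1)]
      rcases Nat.lt_succ_iff_lt_or_eq.1 hi with hlt | rfl
      · rw [Function.update_of_ne (by omega), Function.update_of_ne (by omega)]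
        exact hs i hlt
      · rwa [Function.update_self, Function.update_self, hn]
    · rw [hobs, hβ, filterMap_range_succ, Function.update_self]
      congr 1
      refine List.filterMap_congr fun i hi => ?_
      rw [Function.update_of_ne (List.mem_range.1 hi).ne]

theorem exists_symPath_of_mem_traces {X : Type} [DecidableEq X] {Q : Prog X}
    (hterm : Terminating Q) {t : Trace X} (ht : t ∈ Traces Q) :
    ∃ σ : Store X, ∃ p ∈ SymPathsMax Q, p.1 σ ∧ t.Agree (evalTrace p.2 σ) := by
  obtain ⟨σ, ρ, hmax, rfl⟩ := ht
  obtain ⟨n, hn⟩ := hterm σ ρ hmax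
  have hskip : (ρ.cfg n).1 = Prog.skip := by
    rcases hmax with htop | ⟨m, hm, hskip⟩
    · simp [hn] at htop
    · rw [hn, Nat.cast_inj] at hm
      rwa [hm]
  obtain ⟨ν, α, β, hrun, -, hα, hβ⟩ := ρ.exists_symbolic n hn.ge
  rw [hskip] at hrun
  exact ⟨σ, (α, β), ⟨⟨ν, hrun⟩, σ, hα⟩, hα, ρ.obs_agree hn hβ⟩

theorem exists_trace_of_mem_symPathsMax {X : Type} [DecidableEq X] {Q : Prog X}
    {p : SymPath X} (hp : p ∈ SymPathsMax Q) {σ : Store X} (hσ : p.1 σ) :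
    ∃ t ∈ Traces Q, t.Agree (evalTrace p.2 σ) := by
  obtain ⟨⟨ν, hrun⟩, -⟩ := hp
  obtain ⟨n, cfg, lbl, h0, hs, hn, hβ⟩ := exists_steps_of_symbolic hrun hσ
  let ρ : Exec (Q, σ) := ⟨n, cfg, lbl, h0, fun i hi => hs i (by exact_mod_cast hi)⟩
  exact ⟨ρ.obs, ⟨σ, ρ, .inr ⟨n, rfl, congrArg Prod.fst hn⟩, rfl⟩, ρ.obs_agree rfl hβ⟩

theorem agree_snoc {X : Type} {n : ℕ} {Tr : Fin n → Trace X} {v : Fin n → Store X}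
    {Δ : Fin n → List (SymStore X)} (h : ∀ j, (Tr j).Agree (evalTrace (Δ j) (v j)))
    {t : Trace X} {σ : Store X} {β : List (SymStore X)} (ht : t.Agree (evalTrace β σ))
    (j : Fin (n + 1)) :
    (Fin.snoc (α := fun _ => Trace X) Tr t j).Agree
      (evalTrace (Fin.snoc (α := fun _ => List (SymStore X)) Δ β j)
        (Fin.snoc (α := fun _ => Store X) v σ j)) := by
  refine Fin.lastCases ?_ (fun j => ?_) j
  · simpa using ht
  · simpa using h j

theorem hSat_traces_iff_enc {X : Type} [DecidableEq X] {Q : Prog X} (hterm : Terminating Q)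
    {n : ℕ} (φ : HyperLTL X n) {Tr : Fin n → Trace X} {v : Fin n → Store X}
    {Δ : Fin n → List (SymStore X)} (h : ∀ j, (Tr j).Agree (evalTrace (Δ j) (v j))) :
    HSat (Traces Q) φ Tr ↔ enc (SymPathsMax Q) φ v Δ := by
  induction φ with
  | body ψ =>
    simp only [HSat, enc]
    exact bodySat_congr h ψ 0
  | uall φ ih =>
    simp only [HSat, enc]
    constructor
    · intro hall σ p hp hσ
      obtain ⟨t, ht, hagree⟩ := exists_trace_of_mem_symPathsMax hp hσ
      exact (ih (agree_snoc h hagree)).1 (hall t ht)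
    · intro hall t ht
      obtain ⟨σ, p, hp, hσ, hagree⟩ := exists_symPath_of_mem_traces hterm ht
      exact (ih (agree_snoc h hagree)).2 (hall σ p hp hσ)
  | uex φ ih =>
    simp only [HSat, enc]
    constructor
    · rintro ⟨t, ht, hsat⟩
      obtain ⟨σ, p, hp, hσ, hagree⟩ := exists_symPath_of_mem_traces hterm ht
      exact ⟨σ, p, hp, hσ, (ih (agree_snoc h hagree)).1 hsat⟩
    · rintro ⟨σ, p, hp, hσ, hsat⟩
      obtain ⟨t, ht, hagree⟩ := exists_trace_of_mem_symPathsMax hp hσ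
      exact ⟨t, ht, (ih (agree_snoc h hagree)).2 hsat⟩

/-- Proposition 1. For a terminating program `Q` with finitely
many satisfiable maximal symbolic paths, `Q ⊨ φ` iff the encoding
`enc^φ_{SymPaths_max(Q)}` is valid. -/
theorem enc_correct {X : Type} [DecidableEq X] (Q : Prog X) (φ : HyperLTL X 0)
    (hterm : Terminating Q) (hfin : (SymPathsMax Q).Finite) :
    Sat Q φ ↔ enc (SymPathsMax Q) φ Fin.elim0 Fin.elim0 :=
  hSat_traces_iff_enc hterm φ fun j => j.elim0

end HyRep
end
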